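/- There exist two tetrahedra with congruent base triangles and equal heights (hence equal volume) that are not scissors-congruent to each other. -/

import Mathlib

noncomputable section

/-- 3-dimensional Euclidean space. -/
abbrev E3 : Type := EuclideanSpace ℝ (Fin 3)

/-- A (convex) polytope: the convex hull of a finite set of points. -/
def IsPolytope (s : Set E3) : Prop := ∃ t : Finset E3, s = convexHull ℝ (t : Set E3)

/-- Scissors congruence. -/
def ScissorsCongruent (P Q : Set E3) : Prop :=
  ∃ (n : ℕ) (Ps Qs : Fin n → Set E3),
    (∀ i, IsPolytope (Ps i)) ∧
    P = ⋃ i, Ps i ∧ Q = ⋃ i, Qs i ∧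
    (∀ i j, i ≠ j → interior (Ps i) ∩ interior (Ps j) = ∅) ∧
    (∀ i j, i ≠ j → interior (Qs i) ∩ interior (Qs j) = ∅) ∧
    (∀ i, ∃ f : E3 ≃ᵢ E3, Qs i = f '' Ps i)

open MeasureTheory Set

/-- Tangent cone of `P` at `x` (empty if `x ∉ P`). -/
def TC (P : Set E3) (x : E3) : Set E3 := {u | x ∈ P ∧ ∃ ε : ℝ, 0 < ε ∧ x + ε • u ∈ P}

/-- Solid angle of `P` at `x`. -/
def SA (P : Set E3) (x : E3) : ℝ := (volume : Measure E3).real (TC P x ∩ Metric.closedBall 0 1)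

lemma TC_small {P : Set E3} (hP : Convex ℝ P) {x u : E3} (hx : x ∈ P) {ε δ : ℝ} (hε : 0 < ε)
    (h : x + ε • u ∈ P) (h0 : 0 ≤ δ) (h1 : δ ≤ ε) : x + δ • u ∈ P := by
  have := hP.add_smul_mem hx h (t := δ / ε) ⟨by positivity, by rw [div_le_one hε]; exact h1⟩
  rw [smul_smul, div_mul_cancel₀ _ hε.ne'] at this
  exact this

lemma TC_smul {P : Set E3} {x u : E3} (hu : u ∈ TC P x) {c : ℝ} (hc : 0 ≤ c) : c • u ∈ TC P x := by
  obtain ⟨hx, ε, hε, h⟩ := hu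
  rcases hc.eq_or_lt with rfl | hc
  · exact ⟨hx, 1, one_pos, by simpa using hx⟩
  · refine ⟨hx, ε / c, by positivity, ?_⟩
    rw [smul_smul, div_mul_cancel₀ _ hc.ne']; exact h

lemma TC_add {P : Set E3} (hP : Convex ℝ P) {x u v : E3} (hu : u ∈ TC P x) (hv : v ∈ TC P x) :
    u + v ∈ TC P x := by
  obtain ⟨hx, ε, hε, h⟩ := hu
  obtain ⟨-, ε', hε', h'⟩ := hv
  have m : 0 < min ε ε' := lt_min hε hε'
  have a := TC_small hP hx hε h m.le (min_le_left _ _)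
  have b := TC_small hP hx hε' h' m.le (min_le_right _ _)
  refine ⟨hx, min ε ε' / 2, by positivity, ?_⟩
  have := hP a b (a := 1/2) (b := 1/2) (by norm_num) (by norm_num) (by norm_num)
  convert this using 1
  module

lemma TC_convex {P : Set E3} (hP : Convex ℝ P) (x : E3) : Convex ℝ (TC P x) :=
  fun _ hu _ hv _ _ ha hb _ => TC_add hP (TC_smul hu ha) (TC_smul hv hb)

lemma TC_sum {P : Set E3} (hP : Convex ℝ P) {x : E3} (hx : x ∈ P) {ι : Type*} (s : Finset ι)
    (f : ι → E3) (h : ∀ i ∈ s, f i ∈ TC P x) : ∑ i ∈ s, f i ∈ TC P x := by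
  classical
  induction s using Finset.induction_on with
  | empty => simpa using ⟨hx, 1, one_pos, by simpa using hx⟩
  | insert a s ha ih =>
    rw [Finset.sum_insert ha]
    exact TC_add hP (h _ (by simp)) (ih fun i hi => h i (by simp [hi]))

lemma SA_image (f : E3 ≃ᵢ E3) (P : Set E3) (x : E3) : SA (f '' P) (f x) = SA P x := by
  set g := f.toRealAffineIsometryEquiv with hg
  have hgf : ∀ y, f y = g y := fun y => by rw [hg, IsometryEquiv.coeFn_toRealAffineIsometryEquiv]
  set L := g.linearIsometryEquiv with hL
  have key : ∀ (u : E3) (ε : ℝ), f x + ε • L u = f (x + ε • u) := by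
    intro u ε
    rw [hgf, hgf]
    have := g.map_vadd x (ε • u)
    simp only [vadd_eq_add] at this
    rw [add_comm x, this, map_smul, add_comm]
  have hT : L ⁻¹' (TC (f '' P) (f x) ∩ Metric.closedBall 0 1) = TC P x ∩ Metric.closedBall 0 1 := by
    ext u
    simp [TC, key]
  unfold SA
  have hm : MeasurePreserving L.toHomeomorph.toMeasurableEquiv (volume : Measure E3) volume :=
    LinearIsometryEquiv.measurePreserving L
  rw [← hT, measureReal_def, measureReal_def]
  exact congrArg _ (hm.measure_preimage_equiv _).symm

lemma null_inter {P Q : Set E3} (hP : Convex ℝ P) (hQ : Convex ℝ Q)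
    (h : interior P ∩ interior Q = ∅) : (volume : Measure E3) (P ∩ Q) = 0 := by
  refine measure_mono_null (t := frontier P ∪ frontier Q) ?_
    (measure_union_null (hP.addHaar_frontier _) (hQ.addHaar_frontier _))
  rintro x ⟨hxP, hxQ⟩
  by_contra hc
  simp only [mem_union, not_or, frontier, mem_sdiff, not_and, not_not] at hc
  have : x ∈ interior P ∩ interior Q := ⟨hc.1 (subset_closure hxP), hc.2 (subset_closure hxQ)⟩
  rw [h] at this; exact this

lemma null_TC {P Q : Set E3} (hP : Convex ℝ P) (hQ : Convex ℝ Q)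
    (h : interior P ∩ interior Q = ∅) (x : E3) : (volume : Measure E3) (TC P x ∩ TC Q x) = 0 := by
  have h0 := null_inter hP hQ h
  refine measure_mono_null
    (t := ⋃ n : ℕ, (fun u : E3 => (1 / ((n:ℝ) + 1)) • u) ⁻¹' ((fun u => x + u) ⁻¹' (P ∩ Q))) ?_ ?_
  · rintro u ⟨⟨hx, ε, hε, h1⟩, hx', ε', hε', h2⟩
    obtain ⟨n, hn⟩ := exists_nat_one_div_lt (lt_min hε hε')
    refine mem_iUnion.2 ⟨n, ?_, ?_⟩
    · exact TC_small hP hx hε h1 (by positivity) (hn.le.trans (min_le_left _ _))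
    · exact TC_small hQ hx' hε' h2 (by positivity) (hn.le.trans (min_le_right _ _))
  · refine measure_iUnion_null fun n => ?_
    rw [Measure.addHaar_preimage_smul _ (by positivity), measure_preimage_add, h0, mul_zero]

lemma SA_iUnion {n : ℕ} {P : Set E3} (hP : Convex ℝ P) (Ps : Fin n → Set E3)
    (hc : ∀ i, Convex ℝ (Ps i))
    (hcl : ∀ i, IsClosed (Ps i)) (hU : P = ⋃ i, Ps i)
    (hd : ∀ i j, i ≠ j → interior (Ps i) ∩ interior (Ps j) = ∅) (x : E3) :
    SA P x = ∑ i, SA (Ps i) x := by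
  have hT : TC P x = ⋃ i, TC (Ps i) x := by
    apply Subset.antisymm
    · rintro u ⟨hx, ε, hε, hu⟩
      have h1 : ∀ k : ℕ, ∃ i, x + (ε / ((k:ℝ) + 1)) • u ∈ Ps i := by
        intro k
        have := TC_small hP hx hε hu (δ := ε / ((k:ℝ) + 1)) (by positivity)
          (div_le_self hε.le (by linarith [(Nat.cast_nonneg k : (0:ℝ) ≤ k)]))
        rw [hU] at this
        simpa using this
      choose φ hφ using h1
      obtain ⟨i, hi⟩ := Finite.exists_infinite_fiber φ
      have hi' : (φ ⁻¹' {i}).Infinite := Set.infinite_coe_iff.1 hi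
      have hf : ∃ᶠ k : ℕ in Filter.atTop, x + (ε / ((k:ℝ) + 1)) • u ∈ Ps i := by
        have := Nat.frequently_atTop_iff_infinite.2 hi'
        refine this.mono ?_
        intro k hk
        have hk : φ k = i := hk
        rw [← hk]; exact hφ k
      have ht : Filter.Tendsto (fun k : ℕ => x + (ε / ((k:ℝ) + 1)) • u) Filter.atTop (nhds x) := by
        have h2 : Filter.Tendsto (fun k : ℕ => ε / ((k:ℝ) + 1)) Filter.atTop (nhds 0) := by
          have := (tendsto_one_div_add_atTop_nhds_zero_nat (𝕜 := ℝ)).const_mul ε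
          simpa [div_eq_mul_inv] using this
        simpa using (h2.smul_const u).const_add x
      have hxi : x ∈ Ps i := (hcl i).mem_of_frequently_of_tendsto hf ht
      obtain ⟨k, hk⟩ := hf.exists
      exact mem_iUnion.2 ⟨i, hxi, _, by positivity, hk⟩
    · refine iUnion_subset fun i => ?_
      rintro u ⟨hx, ε, hε, hu⟩
      exact ⟨hU ▸ mem_iUnion.2 ⟨i, hx⟩, ε, hε, hU ▸ mem_iUnion.2 ⟨i, hu⟩⟩
  unfold SA
  rw [hT, iUnion_inter, measureReal_def, measure_iUnion₀, tsum_fintype, ENNReal.toReal_sum]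
  · rfl
  · intro i _
    exact ((measure_mono inter_subset_right).trans_lt measure_closedBall_lt_top).ne
  · intro i j hij
    exact measure_mono_null (inter_subset_inter inter_subset_left inter_subset_left)
      (null_TC (hc i) (hc j) (hd i j hij) x)
  · intro i
    exact ((TC_convex (hc i) x).inter (convex_closedBall _ _)).nullMeasurableSet _

lemma IsPolytope.convex {P : Set E3} (h : IsPolytope P) : Convex ℝ P := by
  obtain ⟨t, rfl⟩ := h; exact convex_convexHull _ _

lemma IsPolytope.isClosed {P : Set E3} (h : IsPolytope P) : IsClosed P := by
  obtain ⟨t, rfl⟩ := h; exact t.finite_toSet.isClosed_convexHull ℝ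

lemma IsPolytope.image {P : Set E3} (h : IsPolytope P) (f : E3 ≃ᵢ E3) : IsPolytope (f '' P) := by
  classical
  obtain ⟨t, rfl⟩ := h
  refine ⟨t.image f, ?_⟩
  have := AffineMap.image_convexHull (𝕜 := ℝ)
    (f.toRealAffineIsometryEquiv.toAffineEquiv : E3 →ᵃ[ℝ] E3) (t : Set E3)
  simpa using this
end

noncomputable section
open MeasureTheory Set

def vball : ℝ := (volume : Measure E3).real (Metric.closedBall 0 1)

lemma flat_cases (φ : E3 →ₗ[ℝ] ℝ) (hφ : φ ≠ 0) (T : Set E3)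
    (hadd : ∀ u v, u ∈ T → v ∈ T → u + v ∈ T) (hsm : ∀ u (c : ℝ), u ∈ T → 0 ≤ c → c • u ∈ T)
    (hk : ∀ u, φ u = 0 → u ∈ T) :
    (volume : Measure E3).real (T ∩ Metric.closedBall 0 1) = 0 ∨
    2 * (volume : Measure E3).real (T ∩ Metric.closedBall 0 1) = vball ∨
    (volume : Measure E3).real (T ∩ Metric.closedBall 0 1) = vball := by
  have hker : (volume : Measure E3) {u | φ u = 0} = 0 := by
    have := Measure.addHaar_submodule (volume : Measure E3) (LinearMap.ker φ)
      (by rwa [Ne, LinearMap.ker_eq_top])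
    exact this
  have hcont : Continuous φ := φ.continuous_of_finiteDimensional
  -- propagation
  have prop : ∀ u v, u ∈ T → 0 < φ u * φ v → v ∈ T := by
    intro u v hu h
    have hu0 : φ u ≠ 0 := by rintro h0; simp [h0] at h
    have hc : 0 ≤ φ v / φ u := by
      have : φ v / φ u = (φ u * φ v) / (φ u)^2 := by field_simp
      rw [this]; positivity
    have := hadd _ _ (hsm u _ hu hc) (hk (v - (φ v / φ u) • u) (by simp [hu0]))
    simpa using this
  have half : ∀ ψ : E3 →ₗ[ℝ] ℝ, Continuous ψ → (volume : Measure E3) {u | ψ u = 0} = 0 →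
      2 * (volume : Measure E3).real ({u | 0 ≤ ψ u} ∩ Metric.closedBall 0 1) = vball := by
    intro ψ hψ h0
    have m1 : MeasurableSet ({u | 0 ≤ ψ u} ∩ Metric.closedBall (0:E3) 1) :=
      (isClosed_le continuous_const hψ).measurableSet.inter Metric.isClosed_closedBall.measurableSet
    have m2 : MeasurableSet ({u | ψ u ≤ 0} ∩ Metric.closedBall (0:E3) 1) :=
      (isClosed_le hψ continuous_const).measurableSet.inter Metric.isClosed_closedBall.measurableSet
    have e1 : (volume : Measure E3).real ({u | ψ u ≤ 0} ∩ Metric.closedBall 0 1) =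
        (volume : Measure E3).real ({u | 0 ≤ ψ u} ∩ Metric.closedBall 0 1) := by
      rw [measureReal_def, measureReal_def, ← Measure.measure_preimage_neg]
      congr 2
      ext u; simp
    have fin : ∀ s : Set E3, (volume : Measure E3) (s ∩ Metric.closedBall 0 1) ≠ ⊤ := fun s =>
      ((measure_mono inter_subset_right).trans_lt measure_closedBall_lt_top).ne
    have e2 := measureReal_union_add_inter (μ := (volume : Measure E3))
      (s := ({u | 0 ≤ ψ u} ∩ Metric.closedBall (0:E3) 1)) m2 (fin _) (fin _)
    have e3 : (volume : Measure E3).real (({u | 0 ≤ ψ u} ∩ Metric.closedBall (0:E3) 1) ∩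
       ({u | ψ u ≤ 0} ∩ Metric.closedBall (0:E3) 1)) = 0 := by
      rw [measureReal_def, measure_mono_null _ h0]; · rfl
      rintro u ⟨⟨h1, -⟩, h2, -⟩
      exact le_antisymm h2 h1
    have e4 : ({u | 0 ≤ ψ u} ∩ Metric.closedBall (0:E3) 1) ∪
       ({u | ψ u ≤ 0} ∩ Metric.closedBall (0:E3) 1) = Metric.closedBall (0:E3) 1 := by
      rw [← union_inter_distrib_right, inter_eq_right]
      intro u _
      exact le_total 0 (ψ u)
    rw [e4, e3, e1] at e2
    unfold vball; linarith
  by_cases hp : ∃ u ∈ T, 0 < φ u <;> by_cases hn : ∃ u ∈ T, φ u < 0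
  · right; right
    have : T = univ := by
      refine eq_univ_of_forall fun v => ?_
      obtain ⟨u, hu, hu'⟩ := hp
      obtain ⟨w, hw, hw'⟩ := hn
      rcases lt_trichotomy (φ v) 0 with h | h | h
      · exact prop w v hw (mul_pos_of_neg_of_neg hw' h)
      · exact hk v h
      · exact prop u v hu (mul_pos hu' h)
    rw [this, univ_inter]; rfl
  · right; left
    have : T = {u | 0 ≤ φ u} := by
      push Not at hn
      ext v; refine ⟨fun h => hn v h, fun h => ?_⟩
      obtain ⟨u, hu, hu'⟩ := hp
      rcases (show 0 ≤ φ v from h).eq_or_lt with h | h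
      · exact hk v h.symm
      · exact prop u v hu (mul_pos hu' h)
    rw [this]; exact half φ hcont hker
  · right; left
    have : T = {u | 0 ≤ (-φ) u} := by
      push Not at hp
      ext v; refine ⟨fun h => by simpa using hp v h, fun h => ?_⟩
      obtain ⟨u, hu, hu'⟩ := hn
      have h : φ v ≤ 0 := by simpa using h
      rcases h.eq_or_lt with h | h
      · exact hk v h
      · exact prop u v hu (mul_pos_of_neg_of_neg hu' h)
    rw [this]
    refine half (-φ) (by simpa using hcont.neg) (by simpa using hker)
  · left
    push Not at hp hn
    rw [measureReal_def, measure_mono_null _ hker]; · rfl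
    rintro u ⟨hu, -⟩
    exact le_antisymm (hp u hu) (hn u hu)

open scoped ENNReal

def kk : ℝ≥0∞ := ∫⁻ z : ℝ, ∫⁻ r in Ioi (0:ℝ), ENNReal.ofReal r * (if z^2 + r^2 ≤ 1 then 1 else 0)

def cyl : E3 → ℝ × (ℝ × ℝ) := fun x => (x 2, (x 0, x 1))

lemma cyl_mp : MeasurePreserving cyl (volume : Measure E3) volume := by
  have h1 := PiLp.volume_preserving_ofLp (Fin 3)
  have h2 := volume_preserving_piFinSuccAbove (fun _ : Fin 3 => ℝ) 2
  have h3 := (MeasurePreserving.id (volume : Measure ℝ)).prod (volume_preserving_finTwoArrow ℝ)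
  exact h3.comp (h2.comp h1)

lemma sector (G : Set (ℝ × ℝ)) (hG : MeasurableSet G) (S : Set ℝ) (hS : MeasurableSet S)
    (hS' : S ⊆ Ioo (-Real.pi) Real.pi)
    (h : ∀ r φ : ℝ, 0 < r → φ ∈ Ioo (-Real.pi) Real.pi →
      ((r * Real.cos φ, r * Real.sin φ) ∈ G ↔ φ ∈ S)) :
    (volume : Measure E3) ({x | (x 0, x 1) ∈ G} ∩ Metric.closedBall 0 1) = kk * volume S := by
  classical
  have hmB : MeasurableSet {p : ℝ × (ℝ × ℝ) | p.1^2 + (p.2.1^2 + p.2.2^2) ≤ 1} :=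
    measurableSet_le (by fun_prop) (by fun_prop)
  set B : Set (ℝ × (ℝ × ℝ)) := {p | p.1^2 + (p.2.1^2 + p.2.2^2) ≤ 1} ∩ {p | p.2 ∈ G} with hB
  have hBm : MeasurableSet B := hmB.inter (measurable_snd hG)
  have e1 : {x : E3 | (x 0, x 1) ∈ G} ∩ Metric.closedBall 0 1 = cyl ⁻¹' B := by
    ext x
    simp only [hB, cyl, mem_inter_iff, mem_ofPred_eq, mem_preimage, mem_closedBall_zero_iff]
    rw [and_comm, EuclideanSpace.norm_eq, Real.sqrt_le_one]
    simp only [Fin.sum_univ_three, Real.norm_eq_abs, sq_abs]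
    rw [show x.ofLp 0 ^ 2 + x.ofLp 1 ^ 2 + x.ofLp 2 ^ 2
      = x.ofLp 2 ^ 2 + (x.ofLp 0 ^ 2 + x.ofLp 1 ^ 2) by ring]
  rw [e1, cyl_mp.measure_preimage hBm.nullMeasurableSet]
  rw [Measure.volume_eq_prod, Measure.prod_apply hBm]
  unfold kk
  rw [← lintegral_mul_const]
  swap
  · refine Measurable.lintegral_prod_right' (f := fun p : ℝ × ℝ =>
      ENNReal.ofReal p.2 * (if p.1^2 + p.2^2 ≤ 1 then 1 else 0)) ?_
    refine Measurable.mul (by fun_prop) (Measurable.ite ?_ measurable_const measurable_const)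
    exact measurableSet_le (by fun_prop) (by fun_prop)
  congr 1
  ext z
  have hz : MeasurableSet (Prod.mk z ⁻¹' B) := measurable_prodMk_left hBm
  rw [← lintegral_indicator_one hz, ← lintegral_comp_polarCoord_symm]
  have e2 : ∫⁻ p in polarCoord.target, ENNReal.ofReal p.1 •
        (Prod.mk z ⁻¹' B).indicator (1 : ℝ × ℝ → ℝ≥0∞) (polarCoord.symm p) =
      ∫⁻ p in polarCoord.target, (ENNReal.ofReal p.1 * (if z^2 + p.1^2 ≤ 1 then 1 else 0)) *
        S.indicator 1 p.2 := by
    refine setLIntegral_congr_fun polarCoord.open_target.measurableSet (fun p hp ↦ ?_)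
    obtain ⟨hp1, hp2⟩ := hp
    have hh := h p.1 p.2 hp1 hp2
    have hm : polarCoord.symm p ∈ Prod.mk z ⁻¹' B ↔ (z^2 + p.1^2 ≤ 1 ∧ p.2 ∈ S) := by
      simp only [hB, mem_preimage, mem_inter_iff, mem_ofPred_eq, polarCoord_symm_apply, hh]
      rw [show (p.1 * Real.cos p.2)^2 + (p.1 * Real.sin p.2)^2
        = p.1^2 * (Real.sin p.2^2 + Real.cos p.2^2) by ring, Real.sin_sq_add_cos_sq, mul_one]
    by_cases c1 : z^2 + p.1^2 ≤ 1 <;> by_cases c2 : p.2 ∈ S <;>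
      simp only [indicator, hm, c1, c2] <;> simp
  rw [e2, polarCoord_target, Measure.volume_eq_prod, ← Measure.prod_restrict,
    lintegral_prod_mul (f := fun r => ENNReal.ofReal r * (if z^2 + r^2 ≤ 1 then 1 else 0))
      (g := S.indicator 1)]
  · rw [lintegral_indicator_one hS, Measure.restrict_apply hS, inter_eq_left.2 hS']
  · refine Measurable.aemeasurable ?_
    refine Measurable.mul (by fun_prop) (Measurable.ite ?_ measurable_const measurable_const)
    exact measurableSet_le (by fun_prop) (by fun_prop)
  · exact ((measurable_one).indicator hS).aemeasurable

lemma vball_eq : vball = kk.toReal * (2 * Real.pi) := by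
  have := sector univ MeasurableSet.univ (Ioo (-Real.pi) Real.pi) measurableSet_Ioo subset_rfl
    (by intro r φ _ h; simpa using h)
  simp only [mem_univ, ofPred_true, univ_inter, Real.volume_Ioo] at this
  rw [vball, measureReal_def, this, ENNReal.toReal_mul, ENNReal.toReal_ofReal]
  · ring
  · linarith [Real.pi_pos]

lemma vball_pos : 0 < vball := by
  unfold vball
  exact ENNReal.toReal_pos (Metric.measure_closedBall_pos _ _ one_pos).ne' measure_closedBall_lt_top.ne

lemma kk_pos : 0 < kk.toReal := by
  have := vball_pos
  rw [vball_eq] at this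
  exact pos_of_mul_pos_left this (by positivity)

lemma wedge_std (γ : ℝ) (h0 : 0 < γ) (h1 : γ < Real.pi) :
    (volume : Measure E3).real ({x | 0 ≤ x 0 ∧ 0 ≤ Real.cos γ * x 0 + Real.sin γ * x 1} ∩
      Metric.closedBall 0 1) = kk.toReal * (Real.pi - γ) := by
  have hG : MeasurableSet {p : ℝ × ℝ | 0 ≤ p.1 ∧ 0 ≤ Real.cos γ * p.1 + Real.sin γ * p.2} := by
    have h1 : MeasurableSet {p : ℝ × ℝ | 0 ≤ p.1} := measurableSet_le (by fun_prop) (by fun_prop)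
    have h2 : MeasurableSet {p : ℝ × ℝ | 0 ≤ Real.cos γ * p.1 + Real.sin γ * p.2} :=
      measurableSet_le (by fun_prop) (by fun_prop)
    exact h1.inter h2
  have := sector {p | 0 ≤ p.1 ∧ 0 ≤ Real.cos γ * p.1 + Real.sin γ * p.2} hG
    (Icc (γ - Real.pi / 2) (Real.pi / 2)) measurableSet_Icc
    (by intro x hx; constructor <;> linarith [hx.1, hx.2, Real.pi_pos]) ?_
  · simp only [mem_ofPred_eq, Real.volume_Icc] at this
    rw [measureReal_def, this, ENNReal.toReal_mul, ENNReal.toReal_ofReal]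
    · ring
    · linarith
  · intro r φ hr hφ
    simp only [mem_ofPred_eq, mem_Icc]
    have e : Real.cos γ * (r * Real.cos φ) + Real.sin γ * (r * Real.sin φ)
      = r * Real.cos (φ - γ) := by rw [Real.cos_sub]; ring
    rw [e, mul_nonneg_iff_of_pos_left hr, mul_nonneg_iff_of_pos_left hr]
    constructor
    · rintro ⟨a, b⟩
      have a1 : φ ≤ Real.pi / 2 := by
        by_contra hc
        push Not at hc
        exact absurd a (not_le.2 (Real.cos_neg_of_pi_div_two_lt_of_lt hc (by linarith [hφ.2, Real.pi_pos])))
      have a2 : -(Real.pi / 2) ≤ φ := by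
        by_contra hc
        push Not at hc
        rw [← Real.cos_neg] at a
        exact absurd a (not_le.2 (Real.cos_neg_of_pi_div_two_lt_of_lt (by linarith) (by linarith [hφ.1, Real.pi_pos])))
      refine ⟨?_, a1⟩
      by_contra hc
      push Not at hc
      rw [← Real.cos_neg] at b
      exact absurd b (not_le.2 (Real.cos_neg_of_pi_div_two_lt_of_lt (by linarith) (by linarith)))
    · rintro ⟨a, b⟩
      exact ⟨Real.cos_nonneg_of_neg_pi_div_two_le_of_le (by linarith) b,
        Real.cos_nonneg_of_neg_pi_div_two_le_of_le (by linarith) (by linarith)⟩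

lemma wedge_vol (a b : E3) (γ : ℝ) (h0 : 0 < γ) (h1 : γ < Real.pi) (ha : a ≠ 0) (hb : b ≠ 0)
    (hab : inner ℝ a b = Real.cos γ * (‖a‖ * ‖b‖)) :
    (volume : Measure E3).real ({x | 0 ≤ inner ℝ a x ∧ 0 ≤ inner ℝ b x} ∩
      Metric.closedBall 0 1) = kk.toReal * (Real.pi - γ) := by
  have ha' : 0 < ‖a‖ := norm_pos_iff.2 ha
  have hb' : 0 < ‖b‖ := norm_pos_iff.2 hb
  have hs : 0 < Real.sin γ := Real.sin_pos_of_pos_of_lt_pi h0 h1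
  obtain ⟨u, hu⟩ : ∃ u : E3, u = ‖a‖⁻¹ • a := ⟨_, rfl⟩
  obtain ⟨c, hc⟩ : ∃ c : E3, c = ‖b‖⁻¹ • b := ⟨_, rfl⟩
  obtain ⟨w, hw⟩ : ∃ w : E3, w = (Real.sin γ)⁻¹ • (c - Real.cos γ • u) := ⟨_, rfl⟩
  have huu : inner ℝ u u = (1:ℝ) := by
    rw [hu, real_inner_smul_left, real_inner_smul_right, real_inner_self_eq_norm_sq]; field_simp
  have hub : inner ℝ u c = Real.cos γ := by
    rw [hu, hc, real_inner_smul_left, real_inner_smul_right, hab]; field_simp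
  have hbb : inner ℝ c c = (1:ℝ) := by
    rw [hc, real_inner_smul_left, real_inner_smul_right, real_inner_self_eq_norm_sq]; field_simp
  have huw : inner ℝ u w = (0:ℝ) := by
    rw [hw, real_inner_smul_right, inner_sub_right, real_inner_smul_right, huu, hub]; ring
  have hww : inner ℝ w w = (1:ℝ) := by
    rw [hw, real_inner_smul_left, real_inner_smul_right, inner_sub_left, inner_sub_right,
      inner_sub_right, hbb, real_inner_smul_left, real_inner_smul_right, real_inner_smul_left,
      real_inner_smul_right, huu, hub, real_inner_comm, hub]
    have := Real.sin_sq_add_cos_sq γ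
    field_simp
    nlinarith
  have hbw : b = ‖b‖ • (Real.cos γ • u + Real.sin γ • w) := by
    rw [hw, smul_smul, mul_inv_cancel₀ hs.ne', one_smul, add_sub_cancel, hc, smul_smul,
      mul_inv_cancel₀ hb'.ne', one_smul]
  have hau : a = ‖a‖ • u := by rw [hu, smul_smul, mul_inv_cancel₀ ha'.ne', one_smul]
  have hon : Orthonormal ℝ (({0, 1} : Set (Fin 3)).domRestrict (![u, w, 0])) := by
    have nu : ‖u‖ = 1 := by rw [norm_eq_sqrt_real_inner, huu, Real.sqrt_one]
    have nw : ‖w‖ = 1 := by rw [norm_eq_sqrt_real_inner, hww, Real.sqrt_one]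
    constructor
    · rintro ⟨i, hi⟩
      rcases hi with rfl | rfl <;> simp [nu, nw]
    · rintro ⟨i, hi⟩ ⟨j, hj⟩ hij
      rcases hi with rfl | rfl <;> rcases hj with rfl | rfl
      · simp at hij
      · simpa using huw
      · rw [real_inner_comm]; simpa using huw
      · simp at hij
  obtain ⟨B, hB⟩ := hon.exists_orthonormalBasis_extension_of_card_eq (by simp)
  have hB0 : B 0 = u := by simpa using hB 0 (by simp)
  have hB1 : B 1 = w := by simpa using hB 1 (by simp)
  rw [← wedge_std γ h0 h1]
  have hm : MeasurePreserving B.repr.toHomeomorph.toMeasurableEquiv (volume : Measure E3) volume :=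
    LinearIsometryEquiv.measurePreserving B.repr
  rw [measureReal_def, measureReal_def, ← hm.measure_preimage_equiv ({x | 0 ≤ x 0 ∧ _} ∩ _)]
  congr 2
  ext x
  have c0 : B.repr x 0 = inner ℝ u x := by rw [B.repr_apply_apply, hB0]
  have c1 : B.repr x 1 = inner ℝ w x := by rw [B.repr_apply_apply, hB1]
  have i1 : (0 ≤ (inner ℝ a x : ℝ)) ↔ 0 ≤ (inner ℝ u x : ℝ) := by
    conv_lhs => rw [hau, real_inner_smul_left]
    exact mul_nonneg_iff_of_pos_left ha'
  have i2 : (0 ≤ (inner ℝ b x : ℝ)) ↔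
      0 ≤ Real.cos γ * (inner ℝ u x : ℝ) + Real.sin γ * inner ℝ w x := by
    conv_lhs => rw [hbw, real_inner_smul_left, inner_add_left, real_inner_smul_left, real_inner_smul_left]
    exact mul_nonneg_iff_of_pos_left hb'
  have hn : ‖B.repr x‖ = ‖x‖ := B.repr.norm_map x
  change _ ↔ (0 ≤ B.repr x 0 ∧ 0 ≤ Real.cos γ * B.repr x 0 + Real.sin γ * B.repr x 1) ∧
    B.repr x ∈ Metric.closedBall 0 1
  rw [c0, c1, mem_inter_iff, mem_closedBall_zero_iff, mem_closedBall_zero_iff, hn, mem_ofPred_eq,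
    i1, i2]
end

noncomputable section
open MeasureTheory Set

lemma SA_of_notMem {P : Set E3} {x : E3} (hx : x ∉ P) : SA P x = 0 := by
  have : TC P x = ∅ := by ext u; simp [TC, hx]
  simp [SA, this]

lemma f_flat (f : ℝ →ₗ[ℚ] ℚ) (hf : f vball = 0) {r : ℝ}
    (h : r = 0 ∨ 2 * r = vball ∨ r = vball) : f r = 0 := by
  rcases h with h | h | h
  · simp [h]
  · have : f (2 * r) = 2 * f r := by rw [two_mul, map_add, two_mul]
    rw [h, hf] at this
    linarith
  · rw [h, hf]

lemma exists_functional {p q : E3} (h : LinearIndependent ℝ ![p, q]) :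
    ∃ φ : E3 →ₗ[ℝ] ℝ, φ ≠ 0 ∧ ∀ u, φ u = 0 → ∃ a b : ℝ, a • p + b • q = u := by
  set W := Submodule.span ℝ (range ![p, q]) with hW
  have d2 : Module.finrank ℝ W = 2 := by simpa using finrank_span_eq_card h
  have d3 : Module.finrank ℝ E3 = 3 := by simp
  have hlt : W < ⊤ := by
    rw [lt_top_iff_ne_top]; intro h
    rw [h, finrank_top, d3] at d2; omega
  obtain ⟨φ, h0, hle⟩ := Submodule.exists_le_ker_of_lt_top W hlt
  refine ⟨φ, h0, fun u hu => ?_⟩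
  have hk : Module.finrank ℝ (LinearMap.ker φ) < 3 := by
    exact (Submodule.finrank_lt (by rwa [Ne, LinearMap.ker_eq_top])).trans_eq d3
  have : W = LinearMap.ker φ :=
    Submodule.eq_of_le_of_finrank_le hle (by omega)
  have hu : u ∈ W := by rw [this]; exact hu
  rw [hW] at hu
  simp only [Matrix.range_cons, Matrix.range_empty, union_empty, singleton_union] at hu
  exact Submodule.mem_span_pair.1 hu

lemma off_seg (f : ℝ →ₗ[ℚ] ℚ) (hf : f vball = 0) (t : Set E3) (x : E3)
    (hx : f (SA (convexHull ℝ t) x) ≠ 0) : ∃ p ∈ t, ∃ q ∈ t, x ∈ segment ℝ p q := by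
  classical
  set P := convexHull ℝ t with hP
  have hc : Convex ℝ P := convex_convexHull _ _
  have hxP : x ∈ P := by
    by_contra h; exact hx (by rw [SA_of_notMem h, map_zero])
  obtain ⟨ι, _, z, w, hz, hz', hw, hw1, hwx⟩ := eq_pos_convex_span_of_mem_convexHull hxP
  have hzt : ∀ i, z i ∈ t := fun i => hz ⟨i, rfl⟩
  have hzP : ∀ i, z i ∈ P := fun i => subset_convexHull ℝ t (hzt i)
  obtain ⟨i⟩ : Nonempty ι := by
    by_contra h
    rw [not_nonempty_iff] at h
    simp at hw1
  by_cases h1 : ∀ j, j = i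
  · refine ⟨z i, hzt i, z i, hzt i, ?_⟩
    have hu : (Finset.univ : Finset ι) = {i} := by ext j; simp [h1 j]
    rw [hu, Finset.sum_singleton] at hw1 hwx
    rw [hw1, one_smul] at hwx
    rw [hwx]; exact left_mem_segment _ _ _
  push Not at h1
  obtain ⟨j, hj⟩ := h1
  by_cases h2 : ∀ k, k = i ∨ k = j
  · refine ⟨z i, hzt i, z j, hzt j, ?_⟩
    have hu : (Finset.univ : Finset ι) = {i, j} := by ext k; simp [h2 k]
    rw [hu, Finset.sum_pair hj.symm] at hw1 hwx
    exact ⟨w i, w j, (hw i).le, (hw j).le, hw1, hwx⟩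
  push Not at h2
  obtain ⟨k, hki, hkj⟩ := h2
  exfalso
  apply hx
  have hp : ∀ l, z l - x ∈ TC P x := fun l => ⟨hxP, 1, one_pos, by simpa using hzP l⟩
  have hn : ∀ l, x - z l ∈ TC P x := by
    intro l
    have hs : ∑ m, w m • (z m - x) = 0 := by
      simp only [smul_sub, Finset.sum_sub_distrib, ← Finset.sum_smul, hw1, hwx, one_smul, sub_self]
    rw [← Finset.add_sum_erase _ _ (Finset.mem_univ l)] at hs
    have hs' : x - z l = (w l)⁻¹ • ∑ m ∈ Finset.univ.erase l, w m • (z m - x) := by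
      rw [eq_inv_smul_iff₀ (hw l).ne']
      rw [← sub_eq_zero, ← neg_eq_zero, ← hs]; module
    rw [hs']
    exact TC_smul (TC_sum hc hxP _ _ fun m _ => TC_smul (hp m) (hw m).le) (inv_nonneg.2 (hw l).le)
  have hpm : ∀ (a : ℝ) l, a • (z l - x) ∈ TC P x := by
    intro a l
    rcases le_total 0 a with h | h
    · exact TC_smul (hp l) h
    · have := TC_smul (hn l) (c := -a) (by linarith)
      convert this using 1; module
  have hli : LinearIndependent ℝ ![z j - z i, z k - z i] := by
    have h := (affineIndependent_iff_linearIndependent_vsub ℝ z i).1 hz'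
    have := h.comp ![⟨j, hj⟩, ⟨k, hki⟩] (by
      intro a b hab
      fin_cases a <;> fin_cases b <;> simp_all)
    have he : ![z j - z i, z k - z i] =
        (fun m : {m // m ≠ i} => z m -ᵥ z i) ∘ ![⟨j, hj⟩, ⟨k, hki⟩] := by
      funext a; fin_cases a <;> simp
    rw [he]; exact this
  obtain ⟨φ, hφ, hk⟩ := exists_functional hli
  refine f_flat f hf (flat_cases φ hφ (TC P x) (fun u v => TC_add hc) (fun u c h1 h2 => TC_smul h1 h2) ?_)
  intro u hu
  obtain ⟨a, b, rfl⟩ := hk u hu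
  have := TC_add hc (TC_add hc (hpm a j) (hpm b k)) (hpm (-(a+b)) i)
  convert this using 1; module

lemma TC_mono_seg {P : Set E3} (hP : Convex ℝ P) {x y z : E3} (hx : x ∈ P) (hz : z ∈ P) {s : ℝ}
    (h0 : 0 < s) (h1 : s ≤ 1) (h : x = s • y + (1 - s) • z) : TC P y ⊆ TC P x := by
  rintro u ⟨hy, ε, hε, hu⟩
  refine ⟨hx, s * ε, by positivity, ?_⟩
  have := hP hu hz h0.le (sub_nonneg.2 h1) (by ring)
  convert this using 1
  rw [h]; module

lemma TC_seg_le {P : Set E3} (hP : Convex ℝ P) {p q x y : E3} (hp : p ∈ P) (hq : q ∈ P)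
    (hx : x ∈ openSegment ℝ p q) (hy : y ∈ openSegment ℝ p q) : TC P y ⊆ TC P x := by
  have hxP : x ∈ P := hP.openSegment_subset hp hq hx
  rw [openSegment_eq_image] at hx hy
  obtain ⟨a, ⟨ha0, ha1⟩, rfl⟩ := hx
  obtain ⟨b, ⟨hb0, hb1⟩, rfl⟩ := hy
  rcases le_total a b with h | h
  · refine TC_mono_seg hP hxP hp (s := a / b) (by positivity) (by rwa [div_le_one hb0]) ?_
    match_scalars <;> (field_simp; try ring)
  · have hb2 : 0 < 1 - b := by linarith
    refine TC_mono_seg hP hxP hq (s := (1 - a) / (1 - b)) (div_pos (by linarith) hb2)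
      (by rw [div_le_one hb2]; linarith) ?_
    match_scalars <;> (field_simp; try ring)

lemma SA_seg {P : Set E3} (hP : Convex ℝ P) {p q x y : E3} (hp : p ∈ P) (hq : q ∈ P)
    (hx : x ∈ openSegment ℝ p q) (hy : y ∈ openSegment ℝ p q) : SA P x = SA P y := by
  unfold SA
  rw [Subset.antisymm (TC_seg_le hP hp hq hx hy) (TC_seg_le hP hp hq hy hx)]

open scoped MeasureTheory

def gg (f : ℝ →ₗ[ℚ] ℚ) (P : Set E3) (x : E3) : ℝ := (f (SA P x) : ℝ)

lemma gg_int (f : ℝ →ₗ[ℚ] ℚ) (hf : f vball = 0) {P : Set E3} (h : IsPolytope P) :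
    Integrable (gg f P) (Measure.hausdorffMeasure 1 : Measure E3) := by
  obtain ⟨t, rfl⟩ := h
  set P := convexHull ℝ (t : Set E3) with hPdef
  have hP : Convex ℝ P := convex_convexHull _ _
  have htP : ∀ p ∈ t, p ∈ P := fun p hp => subset_convexHull ℝ _ hp
  have hsup : Function.support (gg f P) ⊆ ⋃ e ∈ t ×ˢ t, segment ℝ e.1 e.2 := by
    intro x hx
    have hx : f (SA P x) ≠ 0 := by simpa [gg] using hx
    obtain ⟨p, hp, q, hq, hpq⟩ := off_seg f hf _ x hx
    simp only [mem_iUnion]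
    exact ⟨(p, q), Finset.mem_product.2 ⟨hp, hq⟩, hpq⟩
  rw [← integrableOn_iff_integrable_of_support_subset hsup, integrableOn_finset_iUnion]
  rintro ⟨p, q⟩ he
  obtain ⟨hp, hq⟩ := Finset.mem_product.1 he
  have hna := Measure.nullSingletonClass_hausdorff E3 (d := 1) one_pos
  obtain ⟨c, hc⟩ : ∃ c, ∀ x ∈ openSegment ℝ p q, gg f P x = c := by
    refine ⟨gg f P (midpoint ℝ p q), fun x hx => ?_⟩
    unfold gg
    rw [SA_seg hP (htP p hp) (htP q hq) hx (midpoint_mem_openSegment _ _)]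
  have hm : MeasurableSet (segment ℝ p q) := by
    rw [← convexHull_pair]
    exact ((toFinite {p, q}).isClosed_convexHull ℝ).measurableSet
  refine (integrableOn_const (C := c) (by simp [edist_ne_top]) : IntegrableOn (fun _ => c) _ _).congr ?_
  have h1 : ∀ᵐ x ∂(Measure.hausdorffMeasure 1 : Measure E3), x ∉ ({p, q} : Set E3) :=
    measure_eq_zero_iff_ae_notMem.1 ((toFinite {p, q}).measure_zero _)
  filter_upwards [ae_restrict_of_ae h1, ae_restrict_mem hm] with x hx1 hx2
  rw [hc x]
  rw [← insert_endpoints_openSegment] at hx2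
  simp only [mem_insert_iff, mem_singleton_iff, not_or] at hx1 hx2
  tauto

def DD (f : ℝ →ₗ[ℚ] ℚ) (P : Set E3) : ℝ := ∫ x, gg f P x ∂(Measure.hausdorffMeasure 1 : Measure E3)

lemma DD_image (f : ℝ →ₗ[ℚ] ℚ) (P : Set E3) (e : E3 ≃ᵢ E3) : DD f (e '' P) = DD f P := by
  unfold DD
  have := (e.measurePreserving_hausdorffMeasure 1).integral_comp
    e.toHomeomorph.measurableEmbedding (gg f (e '' P))
  rw [← this]
  simp [gg, SA_image]

lemma DD_iUnion (f : ℝ →ₗ[ℚ] ℚ) (hf : f vball = 0) {n : ℕ} {P : Set E3} (hP : Convex ℝ P)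
    (Ps : Fin n → Set E3) (hp : ∀ i, IsPolytope (Ps i)) (hU : P = ⋃ i, Ps i)
    (hd : ∀ i j, i ≠ j → interior (Ps i) ∩ interior (Ps j) = ∅) :
    DD f P = ∑ i, DD f (Ps i) := by
  unfold DD
  rw [← integral_finsetSum _ fun i _ => gg_int f hf (hp i)]
  congr 1
  ext x
  simp only [gg]
  rw [SA_iUnion hP Ps (fun i => (hp i).convex) (fun i => (hp i).isClosed) hU hd, map_sum]
  push_cast; rfl

lemma DD_scissors (f : ℝ →ₗ[ℚ] ℚ) (hf : f vball = 0) {P Q : Set E3} (hP : Convex ℝ P)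
    (hQ : Convex ℝ Q) (h : ScissorsCongruent P Q) : DD f P = DD f Q := by
  obtain ⟨n, Ps, Qs, hp, hPU, hQU, hPd, hQd, hi⟩ := h
  have hq : ∀ i, IsPolytope (Qs i) := by
    intro i
    obtain ⟨e, he⟩ := hi i
    rw [he]; exact (hp i).image e
  rw [DD_iUnion f hf hP Ps hp hPU hPd, DD_iUnion f hf hQ Qs hq hQU hQd]
  refine Finset.sum_congr rfl fun i _ => ?_
  obtain ⟨e, he⟩ := hi i
  rw [he, DD_image]
end

noncomputable section
open MeasureTheory Set

section tet
variable (a v : Fin 4 → E3) (c : Fin 4 → ℝ)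

structure Bary : Prop where
  sum1 : ∀ x : E3, ∑ k, (inner ℝ (a k) x + c k) = 1
  sumx : ∀ x : E3, ∑ k, (inner ℝ (a k) x + c k) • v k = x
  dl : ∀ k l, inner ℝ (a k) (v l) + c k = if k = l then 1 else 0

variable {a v c}

lemma Bary.hull (h : Bary a v c) :
    convexHull ℝ (range v) = {x | ∀ k, 0 ≤ inner ℝ (a k) x + c k} := by
  apply Subset.antisymm
  · refine convexHull_min ?_ ?_
    · rintro _ ⟨l, rfl⟩ k
      rw [h.dl]; split_ifs <;> norm_num
    · intro x hx y hy s t hs ht hst k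
      have := add_nonneg (mul_nonneg hs (hx k)) (mul_nonneg ht (hy k))
      rw [inner_add_right, real_inner_smul_right, real_inner_smul_right]
      have e : c k = s * c k + t * c k := by rw [← add_mul, hst, one_mul]
      linarith
  · intro x hx
    rw [← h.sumx x]
    exact (convex_convexHull ℝ (range v)).sum_mem (fun k _ => hx k) (h.sum1 x)
      (fun k _ => subset_convexHull _ _ ⟨k, rfl⟩)

lemma Bary.edge (h : Bary a v c) {i j k l : Fin 4} (hij : i ≠ j) (hki : k ≠ i) (hkj : k ≠ j)
    (hli : l ≠ i) (hlj : l ≠ j) (hkl : k ≠ l) {x : E3} (hx : x ∈ openSegment ℝ (v i) (v j)) :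
    SA (convexHull ℝ (range v)) x =
      (volume : Measure E3).real ({x | 0 ≤ inner ℝ (a k) x ∧ 0 ≤ inner ℝ (a l) x} ∩
      Metric.closedBall 0 1) := by
  obtain ⟨s, t, hs, ht, hst, rfl⟩ := hx
  set x := s • v i + t • v j with hx
  have hv : ∀ m, inner ℝ (a m) x + c m = s * (if m = i then 1 else 0) + t * (if m = j then 1 else 0) := by
    intro m
    rw [← h.dl, ← h.dl, hx, inner_add_right, real_inner_smul_right, real_inner_smul_right]
    have e : c m = s * c m + t * c m := by rw [← add_mul, hst, one_mul]
    linarith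
  have hk0 : inner ℝ (a k) x + c k = 0 := by rw [hv]; simp [hki, hkj]
  have hl0 : inner ℝ (a l) x + c l = 0 := by rw [hv]; simp [hli, hlj]
  have hi0 : inner ℝ (a i) x + c i = s := by rw [hv]; simp [hij]
  have hj0 : inner ℝ (a j) x + c j = t := by rw [hv]; simp [hij.symm]
  have hall : ∀ m : Fin 4, m = i ∨ m = j ∨ m = k ∨ m = l := by
    revert hij hki hkj hli hlj hkl
    clear * -
    revert i j k l; decide
  unfold SA
  congr 2
  rw [h.hull]
  ext u
  have hstep : ∀ m (ε : ℝ), inner ℝ (a m) (x + ε • u) + c m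
      = (inner ℝ (a m) x + c m) + ε * inner ℝ (a m) u := by
    intro m ε
    rw [inner_add_right, real_inner_smul_right]; ring
  constructor
  · rintro ⟨-, ε, hε, hu⟩
    have h1 := hu k
    have h2 := hu l
    rw [hstep, hk0, zero_add] at h1
    rw [hstep, hl0, zero_add] at h2
    exact ⟨nonneg_of_mul_nonneg_right h1 hε, nonneg_of_mul_nonneg_right h2 hε⟩
  · rintro ⟨h1, h2⟩
    refine ⟨?_, ?_⟩
    · intro m
      rcases hall m with rfl | rfl | rfl | rfl <;> linarith
    · obtain ⟨M, hM0, hM1, hM2⟩ : ∃ M : ℝ, 0 < M ∧ |(inner ℝ (a i) u : ℝ)| ≤ M ∧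
          |(inner ℝ (a j) u : ℝ)| ≤ M :=
        ⟨|(inner ℝ (a i) u : ℝ)| + |(inner ℝ (a j) u : ℝ)| + 1, by positivity,
          by linarith [abs_nonneg (inner ℝ (a j) u : ℝ)],
          by linarith [abs_nonneg (inner ℝ (a i) u : ℝ)]⟩
      have hmin : 0 < min s t := lt_min hs ht
      have hε : 0 < min s t / M := by positivity
      have hεM : min s t / M * M = min s t := div_mul_cancel₀ _ hM0.ne'
      refine ⟨min s t / M, hε, fun m => ?_⟩
      rw [hstep]
      rcases hall m with rfl | rfl | rfl | rfl
      · rw [hi0]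
        nlinarith [neg_le_of_abs_le hM1, min_le_left s t]
      · rw [hj0]
        nlinarith [neg_le_of_abs_le hM2, min_le_right s t]
      · rw [hk0, zero_add]; positivity
      · rw [hl0, zero_add]; positivity

lemma exists_compl : ∀ i j : Fin 4, i ≠ j → ∃ k l : Fin 4, k < l ∧ k ≠ i ∧ k ≠ j ∧ l ≠ i ∧ l ≠ j := by
  decide

/-- at a non-vertex, either `gg` vanishes or we are inside an edge -/
lemma gg_cases (v : Fin 4 → E3) (f : ℝ →ₗ[ℚ] ℚ) (hf : f vball = 0) (x : E3) (hx : x ∉ range v)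
    (hg : f (SA (convexHull ℝ (range v)) x) ≠ 0) :
    ∃ i j, i ≠ j ∧ x ∈ openSegment ℝ (v i) (v j) := by
  obtain ⟨_, ⟨i, rfl⟩, _, ⟨j, rfl⟩, h⟩ := off_seg f hf _ x hg
  have h1 : x ≠ v i := fun h => hx ⟨i, h.symm⟩
  have h2 : x ≠ v j := fun h => hx ⟨j, h.symm⟩
  refine ⟨i, j, ?_, ?_⟩
  · rintro rfl
    rw [segment_same] at h; exact h1 h
  · rw [← insert_endpoints_openSegment] at h
    simp only [mem_insert_iff] at h
    tauto

lemma ae_notMem_range (v : Fin 4 → E3) :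
    ∀ᵐ x ∂(Measure.hausdorffMeasure 1 : Measure E3), x ∉ range v := by
  have hna := Measure.nullSingletonClass_hausdorff E3 (d := 1) one_pos
  exact measure_eq_zero_iff_ae_notMem.1 ((finite_range v).measure_zero _)

lemma f_rat (f : ℝ →ₗ[ℚ] ℚ) (hf : f vball = 0) (q : ℚ) (γ : ℝ) (h : γ = q * Real.pi) :
    f (kk.toReal * (Real.pi - γ)) = 0 := by
  have : kk.toReal * (Real.pi - γ) = ((1 - q) / 2 : ℚ) • vball := by
    rw [h, vball_eq, Rat.smul_def]; push_cast; ring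
  rw [this, map_smul, hf, smul_zero]

end tet

def av : Fin 4 → E3 := ![!₂[-1,-1,-1], !₂[1,0,0], !₂[0,1,0], !₂[0,0,1]]
def aw : Fin 4 → E3 := ![!₂[-1,-1,0], !₂[1,0,-1], !₂[0,1,0], !₂[0,0,1]]
def vv : Fin 4 → E3 := ![!₂[0,0,0], !₂[1,0,0], !₂[0,1,0], !₂[0,0,1]]
def ww : Fin 4 → E3 := ![!₂[0,0,0], !₂[1,0,0], !₂[0,1,0], !₂[1,0,1]]
def cc : Fin 4 → ℝ := ![1,0,0,0]

lemma bary_v : Bary av vv cc where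
  sum1 x := by
    simp [av, cc, Fin.sum_univ_four, PiLp.inner_apply, Fin.sum_univ_three]; ring
  sumx x := by
    ext i; fin_cases i <;>
    simp [av, vv, cc, Fin.sum_univ_four, PiLp.inner_apply, Fin.sum_univ_three]
  dl k l := by
    fin_cases k <;> fin_cases l <;> simp [av, vv, cc, PiLp.inner_apply, Fin.sum_univ_three, EuclideanSpace.norm_eq]

lemma bary_w : Bary aw ww cc where
  sum1 x := by
    simp [aw, cc, Fin.sum_univ_four, PiLp.inner_apply, Fin.sum_univ_three]; ring
  sumx x := by
    ext i; fin_cases i <;>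
    simp [aw, ww, cc, Fin.sum_univ_four, PiLp.inner_apply, Fin.sum_univ_three]
  dl k l := by
    fin_cases k <;> fin_cases l <;> simp [aw, ww, cc, PiLp.inner_apply, Fin.sum_univ_three, EuclideanSpace.norm_eq]

lemma cos_34 : Real.cos ((3/4 : ℚ) * Real.pi) = - (√2 / 2) := by
  rw [← Real.cos_pi_div_four, ← Real.cos_pi_sub]; congr 1; push_cast; ring
lemma cos_23 : Real.cos ((2/3 : ℚ) * Real.pi) = - (1 / 2) := by
  rw [← Real.cos_pi_div_three, ← Real.cos_pi_sub]; congr 1; push_cast; ring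
lemma cos_12 : Real.cos ((1/2 : ℚ) * Real.pi) = 0 := by
  rw [← Real.cos_pi_div_two]; congr 1; push_cast; ring

lemma aw_ne (k : Fin 4) : aw k ≠ 0 := by
  intro h
  have h0 := congrArg (fun x : E3 => x 0) h
  have h1 := congrArg (fun x : E3 => x 1) h
  have h2 := congrArg (fun x : E3 => x 2) h
  fin_cases k <;> simp [aw] at h0 h1 h2

lemma av_ne (k : Fin 4) : av k ≠ 0 := by
  intro h
  have h0 := congrArg (fun x : E3 => x 0) h
  have h1 := congrArg (fun x : E3 => x 1) h
  have h2 := congrArg (fun x : E3 => x 2) h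
  fin_cases k <;> simp [av] at h0 h1 h2

lemma n_aw : ‖aw 0‖ = √2 ∧ ‖aw 1‖ = √2 ∧ ‖aw 2‖ = 1 ∧ ‖aw 3‖ = 1 := by
  refine ⟨?_, ?_, ?_, ?_⟩ <;>
    simp [aw, EuclideanSpace.norm_eq, Fin.sum_univ_three] <;> norm_num

lemma n_av : ‖av 0‖ = √3 ∧ ‖av 1‖ = 1 ∧ ‖av 2‖ = 1 ∧ ‖av 3‖ = 1 := by
  refine ⟨?_, ?_, ?_, ?_⟩ <;>
    simp [av, EuclideanSpace.norm_eq, Fin.sum_univ_three] <;> norm_num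

lemma data_w (k l : Fin 4) (h : k < l) : ∃ q : ℚ, 0 < q ∧ q < 1 ∧
    inner ℝ (aw k) (aw l) = Real.cos (q * Real.pi) * (‖aw k‖ * ‖aw l‖) := by
  obtain ⟨n0, n1, n2, n3⟩ := n_aw
  have s2 : √2 * √2 = (2:ℝ) := Real.mul_self_sqrt (by norm_num)
  have i01 : inner ℝ (aw 0) (aw 1) = (-1:ℝ) := by simp [aw, PiLp.inner_apply, Fin.sum_univ_three]
  have i02 : inner ℝ (aw 0) (aw 2) = (-1:ℝ) := by simp [aw, PiLp.inner_apply, Fin.sum_univ_three]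
  have i03 : inner ℝ (aw 0) (aw 3) = (0:ℝ) := by simp [aw, PiLp.inner_apply, Fin.sum_univ_three]
  have i12 : inner ℝ (aw 1) (aw 2) = (0:ℝ) := by simp [aw, PiLp.inner_apply, Fin.sum_univ_three]
  have i13 : inner ℝ (aw 1) (aw 3) = (-1:ℝ) := by simp [aw, PiLp.inner_apply, Fin.sum_univ_three]
  have i23 : inner ℝ (aw 2) (aw 3) = (0:ℝ) := by simp [aw, PiLp.inner_apply, Fin.sum_univ_three]
  have hc : (k = 0 ∧ l = 1) ∨ (k = 0 ∧ l = 2) ∨ (k = 0 ∧ l = 3) ∨ (k = 1 ∧ l = 2) ∨ (k = 1 ∧ l = 3)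
      ∨ (k = 2 ∧ l = 3) := by revert k l; decide
  rcases hc with ⟨rfl, rfl⟩ | ⟨rfl, rfl⟩ | ⟨rfl, rfl⟩ | ⟨rfl, rfl⟩ | ⟨rfl, rfl⟩ | ⟨rfl, rfl⟩
  · refine ⟨2/3, by norm_num, by norm_num, ?_⟩
    rw [cos_23, i01, n0, n1]; linarith
  · refine ⟨3/4, by norm_num, by norm_num, ?_⟩
    rw [cos_34, i02, n0, n2]; linarith
  · refine ⟨1/2, by norm_num, by norm_num, ?_⟩
    rw [cos_12, i03, zero_mul]
  · refine ⟨1/2, by norm_num, by norm_num, ?_⟩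
    rw [cos_12, i12, zero_mul]
  · refine ⟨3/4, by norm_num, by norm_num, ?_⟩
    rw [cos_34, i13, n1, n3]; linarith
  · refine ⟨1/2, by norm_num, by norm_num, ?_⟩
    rw [cos_12, i23, zero_mul]

lemma DD_w (f : ℝ →ₗ[ℚ] ℚ) (hf : f vball = 0) : DD f (convexHull ℝ (range ww)) = 0 := by
  refine integral_eq_zero_of_ae ?_
  filter_upwards [ae_notMem_range ww] with x hx
  by_contra hg
  have hg' : f (SA (convexHull ℝ (range ww)) x) ≠ 0 := by simpa [gg] using hg
  obtain ⟨i, j, hij, hxo⟩ := gg_cases ww f hf x hx hg'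
  obtain ⟨k, l, hkl, h1, h2, h3, h4⟩ := exists_compl i j hij
  apply hg'
  obtain ⟨q, q0, q1, hq⟩ := data_w k l hkl
  rw [bary_w.edge hij h1 h2 h3 h4 hkl.ne hxo,
    wedge_vol _ _ (q * Real.pi) (by positivity)
      (by have : (q:ℝ) < 1 := by exact_mod_cast q1
          nlinarith [Real.pi_pos]) (aw_ne k) (aw_ne l) hq]
  exact f_rat f hf q _ rfl

def g0 : ℝ := Real.arccos (-(1/√3))

lemma sqrt3_gt : 1 < √3 := by rw [Real.lt_sqrt] <;> norm_num
lemma inv_sqrt3 : 0 < 1/√3 ∧ 1/√3 < 1 := by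
  have := sqrt3_gt
  exact ⟨by positivity, by rw [div_lt_one (by positivity)]; exact this⟩

lemma cos_g0 : Real.cos g0 = -(1/√3) :=
  Real.cos_arccos (by linarith [inv_sqrt3.2]) (by linarith [inv_sqrt3.1])

lemma g0_pos : 0 < g0 := Real.arccos_pos.2 (by linarith [inv_sqrt3.1])

lemma g0_lt : g0 < Real.pi := by
  refine lt_of_le_of_ne (Real.arccos_le_pi _) fun h => ?_
  have := cos_g0
  rw [show g0 = Real.pi from h, Real.cos_pi] at this
  linarith [inv_sqrt3.2]

lemma g0_irr (q : ℚ) : g0 ≠ q * Real.pi := by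
  intro h
  have h2 : Real.cos (2 * g0) = -1/3 := by
    rw [Real.cos_two_mul, cos_g0]
    have : √3 ^ 2 = (3:ℝ) := Real.sq_sqrt (by norm_num)
    have h3 : √3 ≠ 0 := by linarith [sqrt3_gt]
    rw [neg_sq, div_pow, this]; norm_num
  have := niven (θ := 2 * g0) ⟨2 * q, by rw [h]; push_cast; ring⟩ ⟨-1/3, by rw [h2]; norm_num⟩
  rw [h2] at this
  simp only [mem_insert_iff, mem_singleton_iff] at this
  norm_num at this

lemma exists_f : ∃ f : ℝ →ₗ[ℚ] ℚ, f vball = 0 ∧ f (kk.toReal * (Real.pi - g0)) = 1 := by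
  have hn : kk.toReal * (Real.pi - g0) ∉ Submodule.span ℚ {vball} := by
    intro h
    obtain ⟨q, hq⟩ := Submodule.mem_span_singleton.1 h
    rw [vball_eq, Rat.smul_def] at hq
    have hk := kk_pos
    have : Real.pi - g0 = q * (2 * Real.pi) := by
      apply mul_left_cancel₀ hk.ne'; rw [← hq]; ring
    exact g0_irr (1 - 2 * q) (by push_cast; linarith)
  obtain ⟨f, hf1, hf2⟩ := Submodule.exists_le_ker_of_notMem hn
  have h0 : f vball = 0 := hf2 (Submodule.mem_span_singleton_self _)
  refine ⟨(f (kk.toReal * (Real.pi - g0)))⁻¹ • f, by simp [h0], by simp [hf1]⟩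

lemma data_v (k l : Fin 4) (h : k < l) :
    (k = 0 ∧ inner ℝ (av k) (av l) = Real.cos g0 * (‖av k‖ * ‖av l‖)) ∨
    inner ℝ (av k) (av l) = Real.cos ((1/2 : ℚ) * Real.pi) * (‖av k‖ * ‖av l‖) := by
  obtain ⟨n0, n1, n2, n3⟩ := n_av
  have h3 : √3 ≠ 0 := by linarith [sqrt3_gt]
  have i01 : inner ℝ (av 0) (av 1) = (-1:ℝ) := by simp [av, PiLp.inner_apply, Fin.sum_univ_three]
  have i02 : inner ℝ (av 0) (av 2) = (-1:ℝ) := by simp [av, PiLp.inner_apply, Fin.sum_univ_three]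
  have i03 : inner ℝ (av 0) (av 3) = (-1:ℝ) := by simp [av, PiLp.inner_apply, Fin.sum_univ_three]
  have i12 : inner ℝ (av 1) (av 2) = (0:ℝ) := by simp [av, PiLp.inner_apply, Fin.sum_univ_three]
  have i13 : inner ℝ (av 1) (av 3) = (0:ℝ) := by simp [av, PiLp.inner_apply, Fin.sum_univ_three]
  have i23 : inner ℝ (av 2) (av 3) = (0:ℝ) := by simp [av, PiLp.inner_apply, Fin.sum_univ_three]
  have hc : (k = 0 ∧ l = 1) ∨ (k = 0 ∧ l = 2) ∨ (k = 0 ∧ l = 3) ∨ (k = 1 ∧ l = 2) ∨ (k = 1 ∧ l = 3)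
      ∨ (k = 2 ∧ l = 3) := by revert k l; decide
  rw [cos_g0, cos_12, zero_mul]
  rcases hc with ⟨rfl, rfl⟩ | ⟨rfl, rfl⟩ | ⟨rfl, rfl⟩ | ⟨rfl, rfl⟩ | ⟨rfl, rfl⟩ | ⟨rfl, rfl⟩
  · left; rw [i01, n0, n1]; refine ⟨rfl, ?_⟩; field_simp
  · left; rw [i02, n0, n2]; refine ⟨rfl, ?_⟩; field_simp
  · left; rw [i03, n0, n3]; refine ⟨rfl, ?_⟩; field_simp
  · right; exact i12
  · right; exact i13
  · right; exact i23

lemma DD_v (f : ℝ →ₗ[ℚ] ℚ) (hf : f vball = 0) (h1 : f (kk.toReal * (Real.pi - g0)) = 1) :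
    DD f (convexHull ℝ (range vv)) ≠ 0 := by
  classical
  intro h0
  have hint := gg_int f hf (P := convexHull ℝ (range vv)) ⟨Finset.univ.image vv, by simp⟩
  have hnn : 0 ≤ᵐ[(Measure.hausdorffMeasure 1 : Measure E3)] gg f (convexHull ℝ (range vv)) := by
    filter_upwards [ae_notMem_range vv] with x hx
    by_cases hg : f (SA (convexHull ℝ (range vv)) x) = 0
    · simp [gg, hg]
    obtain ⟨i, j, hij, hxo⟩ := gg_cases vv f hf x hx hg
    obtain ⟨k, l, hkl, e1, e2, e3, e4⟩ := exists_compl i j hij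
    have he := bary_v.edge hij e1 e2 e3 e4 hkl.ne hxo
    rcases data_v k l hkl with ⟨-, hd⟩ | hd
    · rw [wedge_vol _ _ g0 g0_pos g0_lt (av_ne k) (av_ne l) hd] at he
      simp [gg, he, h1]
    · rw [wedge_vol _ _ _ (by positivity) (by push_cast; linarith [Real.pi_pos])
        (av_ne k) (av_ne l) hd] at he
      exact absurd (by rw [he]; exact f_rat f hf _ _ rfl) hg
  have hz := (integral_eq_zero_iff_of_nonneg_ae hnn hint).1 h0
  have hna := Measure.nullSingletonClass_hausdorff E3 (d := 1) one_pos
  have hm : ∀ᵐ x ∂(Measure.hausdorffMeasure 1 : Measure E3), x ∉ segment ℝ (vv 1) (vv 2) := by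
    filter_upwards [ae_notMem_range vv, hz] with x hx hx0 hs
    have hxo : x ∈ openSegment ℝ (vv 1) (vv 2) := by
      have h1 : x ≠ vv 1 := fun h => hx ⟨1, h.symm⟩
      have h2 : x ≠ vv 2 := fun h => hx ⟨2, h.symm⟩
      rw [← insert_endpoints_openSegment] at hs
      simp only [mem_insert_iff] at hs
      tauto
    have he := bary_v.edge (i := 1) (j := 2) (k := 0) (l := 3) (by decide) (by decide) (by decide)
      (by decide) (by decide) (by decide) hxo
    have hd : inner ℝ (av 0) (av 3) = Real.cos g0 * (‖av 0‖ * ‖av 3‖) := by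
      obtain ⟨n0, n1, n2, n3⟩ := n_av
      have h3 : √3 ≠ 0 := by linarith [sqrt3_gt]
      have i03 : inner ℝ (av 0) (av 3) = (-1:ℝ) := by
        simp [av, PiLp.inner_apply, Fin.sum_univ_three]
      rw [cos_g0, i03, n0, n3]; field_simp
    rw [wedge_vol _ _ g0 g0_pos g0_lt (av_ne _) (av_ne _) hd] at he
    simp [gg, he, h1] at hx0
  have := measure_eq_zero_iff_ae_notMem.2 hm
  rw [hausdorffMeasure_segment, edist_eq_zero] at this
  have := congrArg (fun x : E3 => x 0) this
  simp [vv] at this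

/-- Hilbert's third problem (Dehn 1901): there exist two tetrahedra with
congruent base triangles (the first three vertices correspond under an isometry)
and equal heights (distance of the apex to the affine span of the base), which
are nevertheless not scissors-congruent. -/
theorem exists_tetrahedra_equal_base_height_not_scissorsCongruent :
    ∃ (v w : Fin 4 → E3),
      (∃ f : E3 ≃ᵢ E3, ∀ i : Fin 3, w (Fin.castSucc i) = f (v (Fin.castSucc i))) ∧
      Metric.infDist (v 3) (affineSpan ℝ {v 0, v 1, v 2} : Set E3) =
        Metric.infDist (w 3) (affineSpan ℝ {w 0, w 1, w 2} : Set E3) ∧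
      ¬ ScissorsCongruent (convexHull ℝ (Set.range v)) (convexHull ℝ (Set.range w)) := by
  refine ⟨vv, ww, ⟨IsometryEquiv.refl _, ?_⟩, ?_, ?_⟩
  · intro i; fin_cases i <;> rfl
  · have e0 : ww 0 = vv 0 := rfl
    have e1 : ww 1 = vv 1 := rfl
    have e2 : ww 2 = vv 2 := rfl
    rw [e0, e1, e2]
    set S := affineSpan ℝ {vv 0, vv 1, vv 2} with hS
    have e3 : ww 3 = vv 3 + vv 1 := by
      ext i; fin_cases i <;> simp [ww, vv]
    have hd : vv 1 ∈ S.direction := by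
      have z : vv 0 = 0 := by ext i; fin_cases i <;> simp [vv]
      have := AffineSubspace.vsub_mem_direction
        (subset_affineSpan ℝ {vv 0, vv 1, vv 2} (show vv 1 ∈ _ by simp))
        (subset_affineSpan ℝ {vv 0, vv 1, vv 2} (show vv 0 ∈ _ by simp))
      rw [z, vsub_eq_sub, sub_zero] at this
      rw [hS, z]; exact this
    have him : (fun x => x + vv 1) '' (S : Set E3) = S := by
      apply Subset.antisymm
      · rintro _ ⟨x, hx, rfl⟩
        have := AffineSubspace.vadd_mem_of_mem_direction hd hx
        simpa [add_comm] using this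
      · intro x hx
        refine ⟨x - vv 1, ?_, by simp⟩
        have := AffineSubspace.vadd_mem_of_mem_direction (neg_mem hd) hx
        simpa [sub_eq_neg_add] using this
    have := Metric.infDist_image (isometry_add_right (vv 1)) (x := vv 3) (t := (S : Set E3))
    rw [him] at this
    rw [e3, this]
  · intro h
    obtain ⟨f, hf, h1⟩ := exists_f
    exact DD_v f hf h1 ((DD_scissors f hf (convex_convexHull _ _) (convex_convexHull _ _) h).trans
      (DD_w f hf))

end
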